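/- Let E be a closed, simply connected subspace of the Euclidean plane ℝ² in which every two points are connected by a rectifiable path in E. Then E with the induced path metric is uniquely geodesic: between any two points there is exactly one geodesic. -/

import Mathlib

open Set

noncomputable def pathLength {X : Type*} [PseudoEMetricSpace X] {x y : X} (c : Path x y) : ENNReal :=
  eVariationOn (fun t : unitInterval => c t) Set.univ

noncomputable def pathEDist {X : Type*} [PseudoEMetricSpace X] (x y : X) : ENNReal :=
  ⨅ c : Path x y, pathLength c

/-- A unit-speed geodesic segment of the path metric `pathEDist`, parametrized on
`[0, D]`, from `x` to `y`. -/
def IsGeodesicSegment {X : Type*} [MetricSpace X] (γ : ℝ → X) (D : ℝ) (x y : X) : Prop :=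
  γ 0 = x ∧ γ D = y ∧
    ∀ s ∈ Set.Icc 0 D, ∀ t ∈ Set.Icc 0 D, pathEDist (γ s) (γ t) = ENNReal.ofReal |s - t|

section Winding

open Complex Topology

/-- `w` is the increment, along the path `h` on `[a, b]`, of a continuous logarithm of `h - q`. -/
def IsLogIncrement (h : ℝ → ℂ) (a b : ℝ) (q w : ℂ) : Prop :=
  ∃ L : ℝ → ℂ, ContinuousOn L (Icc a b) ∧ (∀ t ∈ Icc a b, exp (L t) = h t - q) ∧ L b - L a = w

lemma IsPreconnected.eq_of_exp_eq_one {X : Type*} [TopologicalSpace X] {s : Set X}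
    (hs : IsPreconnected s) {f : X → ℂ} (hf : ContinuousOn f s) (h1 : ∀ x ∈ s, exp (f x) = 1)
    {x y : X} (hx : x ∈ s) (hy : y ∈ s) : f x = f y := by
  have hT : DiscreteTopology (range ((↑) : ℤ → ℝ)) :=
    Int.isClosedEmbedding_coe_real.isEmbedding.toHomeomorph.symm.isEmbedding.discreteTopology
  have key : ∀ z ∈ s, ∃ n : ℤ, f z = n * (2 * Real.pi * I) := fun z hz => exp_eq_one_iff.1 (h1 z hz)
  have hc : ContinuousOn (fun z => (f z).im / (2 * Real.pi)) s :=
    (continuous_im.comp_continuousOn hf).div_const _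
  have hm : MapsTo (fun z => (f z).im / (2 * Real.pi)) s (range ((↑) : ℤ → ℝ)) := by
    intro z hz
    obtain ⟨n, hn⟩ := key z hz
    refine ⟨n, ?_⟩
    simp only [hn]
    have := Real.pi_ne_zero
    simp [this]
  have h := hs.constant_of_mapsTo ⟨hT⟩ hc hm hx hy
  obtain ⟨n, hn⟩ := key x hx
  obtain ⟨m, hm⟩ := key y hy
  have := Real.pi_ne_zero
  simp only [hn, hm] at h ⊢
  simp [this] at h
  rw [h]

namespace IsLogIncrement

variable {h : ℝ → ℂ} {a b c : ℝ} {p q w w' : ℂ}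

lemma unique (hab : a ≤ b) (h1 : IsLogIncrement h a b q w) (h2 : IsLogIncrement h a b q w') :
    w = w' := by
  obtain ⟨L, hL, hLe, rfl⟩ := h1
  obtain ⟨M, hM, hMe, rfl⟩ := h2
  have := (isPreconnected_Icc (a := a) (b := b)).eq_of_exp_eq_one (hL.sub hM) (fun t ht => by
    rw [Pi.sub_apply, exp_sub, hLe t ht, ← hMe t ht, div_self (exp_ne_zero _)])
    (left_mem_Icc.2 hab) (right_mem_Icc.2 hab)
  simp only [Pi.sub_apply] at this
  linear_combination -this

lemma ne (hw : IsLogIncrement h a b q w) {t : ℝ} (ht : t ∈ Icc a b) : h t ≠ q := by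
  obtain ⟨L, -, hLe, -⟩ := hw
  rw [← sub_ne_zero, ← hLe t ht]
  exact exp_ne_zero _

lemma exp_eq (hab : a ≤ b) (hw : IsLogIncrement h a b q w) :
    exp w = (h b - q) / (h a - q) := by
  obtain ⟨L, hL, hLe, rfl⟩ := hw
  rw [exp_sub, hLe b (right_mem_Icc.2 hab), hLe a (left_mem_Icc.2 hab)]

lemma of_lift (hab : a < b) (Γ : C(unitInterval, ℂ))
    (hΓ : ∀ τ : unitInterval, exp (Γ τ) = h (a + τ * (b - a)) - q) :
    IsLogIncrement h a b q (Γ 1 - Γ 0) := by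
  have hba : b - a ≠ 0 := (sub_pos.2 hab).ne'
  refine ⟨fun t => Γ (projIcc 0 1 zero_le_one ((t - a) / (b - a))), ?_, ?_, ?_⟩
  · exact (Γ.continuous.comp (continuous_projIcc.comp (by fun_prop))).continuousOn
  · intro t ht
    have hmem : (t - a) / (b - a) ∈ Icc (0 : ℝ) 1 :=
      ⟨div_nonneg (sub_nonneg.2 ht.1) (sub_pos.2 hab).le,
        (div_le_one (sub_pos.2 hab)).2 (by linarith [ht.2])⟩
    simp only [hΓ, projIcc_of_mem zero_le_one hmem]
    congr 2
    field_simp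
    ring
  · simp [div_self hba]

lemma exists_of_ne (hab : a < b) (hh : Continuous h) (hq : ∀ t ∈ Icc a b, h t ≠ q) :
    ∃ w, IsLogIncrement h a b q w := by
  have hmem : ∀ τ : unitInterval, a + τ * (b - a) ∈ Icc a b := fun τ =>
    ⟨by nlinarith [τ.2.1], by nlinarith [τ.2.2]⟩
  let γ : C(unitInterval, {z : ℂ // z ≠ 0}) :=
    ⟨fun τ => ⟨h (a + τ * (b - a)) - q, sub_ne_zero.2 (hq _ (hmem τ))⟩, by fun_prop⟩
  obtain ⟨Γ, hΓ, -⟩ := isCoveringMap_exp.exists_path_lifts γ (log (γ 0).1) (by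
    apply Subtype.ext
    simp [exp_log (γ 0).2])
  refine ⟨_, of_lift hab Γ fun τ => ?_⟩
  exact congrArg Subtype.val (congrFun hΓ τ)

lemma eq_of_paths {X : Type*} [TopologicalSpace X] [SimplyConnectedSpace X] {h' : ℝ → ℂ}
    (hab : a < b) (ψ : C(X, ℂ)) (hp : ∀ x, ψ x ≠ p) {x y : X} (c c' : Path x y)
    (hc : ∀ τ : unitInterval, ψ (c τ) = h (a + τ * (b - a)))
    (hc' : ∀ τ : unitInterval, ψ (c' τ) = h' (a + τ * (b - a)))
    (hw : IsLogIncrement h a b p w) (hw' : IsLogIncrement h' a b p w') : w = w' := by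
  let Ψ : C(X, {z : ℂ // z ≠ 0}) := ⟨fun x => ⟨ψ x - p, sub_ne_zero.2 (hp x)⟩, by fun_prop⟩
  have hlog : ∀ e : X, Ψ e = ⟨exp (log (Ψ e).1), exp_ne_zero _⟩ := fun e => by
    apply Subtype.ext
    simp [exp_log (Ψ e).2]
  obtain ⟨H⟩ := SimplyConnectedSpace.paths_homotopic c c'
  have hrel : (Ψ.comp c.toContinuousMap).HomotopicRel (Ψ.comp c'.toContinuousMap) {0, 1} :=
    ⟨H.compContinuousMap Ψ⟩
  have e0 : Ψ.comp c.toContinuousMap 0 = ⟨exp (log (Ψ x).1), exp_ne_zero _⟩ := by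
    rw [← hlog]; simp
  have e0' : Ψ.comp c'.toContinuousMap 0 = ⟨exp (log (Ψ x).1), exp_ne_zero _⟩ := by
    rw [← hlog]; simp
  have h1 := isCoveringMap_exp.liftPath_apply_one_eq_of_homotopicRel hrel (log (Ψ x).1) e0 e0'
  have l1 := isCoveringMap_exp.liftPath_lifts (Ψ.comp c.toContinuousMap) _ e0
  have l2 := isCoveringMap_exp.liftPath_lifts (Ψ.comp c'.toContinuousMap) _ e0'
  have k1 := of_lift (h := h) (q := p) hab _ fun τ =>
    (congrArg Subtype.val (congrFun l1 τ)).trans (congrArg (· - p) (hc τ))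
  have k2 := of_lift (h := h') (q := p) hab _ fun τ =>
    (congrArg Subtype.val (congrFun l2 τ)).trans (congrArg (· - p) (hc' τ))
  rw [hw.unique hab.le k1, hw'.unique hab.le k2, h1, IsCoveringMap.liftPath_zero,
    IsCoveringMap.liftPath_zero]

lemma concat (hab : a < b) (hbc : b < c) (hh : Continuous h) (h1 : IsLogIncrement h a b q w)
    (h2 : IsLogIncrement h b c q w') : IsLogIncrement h a c q (w + w') := by
  obtain ⟨w₀, L, hL, hLe, hw₀⟩ := exists_of_ne (hab.trans hbc) hh (q := q) fun t ht => by
    rcases le_total t b with htb | htb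
    exacts [h1.ne ⟨ht.1, htb⟩, h2.ne ⟨htb, ht.2⟩]
  have e1 : w = L b - L a := h1.unique hab.le
    ⟨L, hL.mono (Icc_subset_Icc_right hbc.le), fun t ht => hLe t ⟨ht.1, ht.2.trans hbc.le⟩, rfl⟩
  have e2 : w' = L c - L b := h2.unique hbc.le
    ⟨L, hL.mono (Icc_subset_Icc_left hab.le), fun t ht => hLe t ⟨hab.le.trans ht.1, ht.2⟩, rfl⟩
  exact ⟨L, hL, hLe, by rw [e1, e2]; ring⟩

lemma _root_.Complex.div_mem_slitPlane_of_notMem_segment {z p q : ℂ} (hz : z ∉ segment ℝ p q) :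
    (z - q) / (z - p) ∈ slitPlane := by
  have hp : z - p ≠ 0 := fun h0 => hz (by rw [sub_eq_zero.1 h0]; exact left_mem_segment _ _ _)
  by_contra hcon
  rw [mem_slitPlane_iff] at hcon
  push Not at hcon
  set u := (z - q) / (z - p) with hu
  have hur : u = (u.re : ℂ) := by apply Complex.ext <;> simp [hcon.2]
  have hz' : z - q = u.re * (z - p) := by rw [← hur, hu]; field_simp
  set r := u.re
  have h1r : (0 : ℝ) < 1 - r := by linarith [hcon.1]
  apply hz
  refine ⟨-r / (1 - r), 1 / (1 - r), div_nonneg (by linarith [hcon.1]) h1r.le, by positivity, ?_, ?_⟩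
  · field_simp; ring
  · have h1c : (1 - (r : ℂ)) ≠ 0 := by exact_mod_cast h1r.ne'
    simp only [real_smul]
    push_cast
    field_simp
    linear_combination -hz'

lemma shift (hh : Continuous h) (hw : IsLogIncrement h a b p w)
    (hseg : ∀ t ∈ Icc a b, h t ∉ segment ℝ p q) :
    IsLogIncrement h a b q
      (w + (log ((h b - q) / (h b - p)) - log ((h a - q) / (h a - p)))) := by
  have hne : ∀ t ∈ Icc a b, h t - p ≠ 0 := fun t ht => sub_ne_zero.2 (hw.ne ht)
  have hsl : ∀ t ∈ Icc a b, (h t - q) / (h t - p) ∈ slitPlane := fun t ht =>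
    div_mem_slitPlane_of_notMem_segment (hseg t ht)
  obtain ⟨L, hL, hLe, rfl⟩ := hw
  refine ⟨fun t => L t + log ((h t - q) / (h t - p)), ?_, ?_, by ring⟩
  · refine hL.add (ContinuousOn.clog ?_ hsl)
    exact ContinuousOn.div (by fun_prop) (by fun_prop) hne
  · intro t ht
    rw [exp_add, hLe t ht, exp_log (slitPlane_ne_zero (hsl t ht))]
    field_simp [hne t ht]

lemma eventually_shift (hh : Continuous h) (hw : IsLogIncrement h a b p w) :
    ∀ᶠ q in 𝓝 p, IsLogIncrement h a b q
      (w + (log ((h b - q) / (h b - p)) - log ((h a - q) / (h a - p)))) := by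
  have hcl : IsOpen (h '' Icc a b)ᶜ := (isCompact_Icc.image hh).isClosed.isOpen_compl
  have hp : p ∈ (h '' Icc a b)ᶜ := by
    rintro ⟨t, ht, rfl⟩
    exact hw.ne ht rfl
  obtain ⟨r, hr, hball⟩ := Metric.isOpen_iff.1 hcl p hp
  filter_upwards [Metric.ball_mem_nhds p hr] with q hq
  refine hw.shift hh fun t ht hs => ?_
  exact hball ((convex_ball p r).segment_subset (Metric.mem_ball_self hr) hq hs) ⟨t, ht, rfl⟩

lemma of_far (hab : a ≤ b) (hh : Continuous h)
    (hfar : ∀ t ∈ Icc a b, dist (h t) (h a) < dist (h a) p) :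
    IsLogIncrement h a b p (log ((h b - p) / (h a - p))) := by
  have ha : h a - p ≠ 0 := sub_ne_zero.2 (dist_pos.1
    (dist_nonneg.trans_lt (hfar a (left_mem_Icc.2 hab))))
  have hsl : ∀ t ∈ Icc a b, (h t - p) / (h a - p) ∈ slitPlane := fun t ht => by
    have : (h t - p) / (h a - p) = 1 + (h t - h a) / (h a - p) := by field_simp; ring
    rw [this]
    refine mem_slitPlane_of_norm_lt_one ?_
    rw [norm_div, div_lt_one (norm_pos_iff.2 ha), ← dist_eq_norm, ← dist_eq_norm]
    exact hfar t ht
  refine ⟨fun t => log ((h t - p) / (h a - p)) + log (h a - p), ?_, ?_, by simp [div_self ha]⟩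
  · exact (ContinuousOn.clog (by fun_prop) hsl).add continuousOn_const
  · intro t ht
    rw [exp_add, exp_log (slitPlane_ne_zero (hsl t ht)), exp_log ha]
    field_simp

end IsLogIncrement

/-- Every point of a simple arc of a closed curve is a limit of points about which the curve has
non-zero winding number. -/
lemma exists_isLogIncrement_ne {g₁ g₂ : ℝ → ℂ} (hg₁ : Continuous g₁) (hg₂ : Continuous g₂)
    {a b t₀ : ℝ} (hat : a < t₀) (htb : t₀ < b) (hinj : InjOn g₁ (Icc a b))
    (ha : g₁ a = g₂ a) (hb : g₁ b = g₂ b) {H : Set ℂ} (hH : IsOpen H) (hzH : g₁ t₀ ∈ H)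
    (h2H : ∀ t ∈ Icc a b, g₂ t ∉ H) :
    ∃ q ∈ H, (∀ t ∈ Icc a b, g₁ t ≠ q) ∧
      ∃ w₁ w₂, IsLogIncrement g₁ a b q w₁ ∧ IsLogIncrement g₂ a b q w₂ ∧ w₁ ≠ w₂ := by
  by_contra! hcon
  have hab := hat.trans htb
  set x := g₁ a with hx
  set y := g₁ b with hy
  set z := g₁ t₀ with hz
  have hxH : x ∉ H := by rw [ha]; exact h2H a (left_mem_Icc.2 hab.le)
  let R : ℂ → ℂ → Prop := fun q w => IsLogIncrement g₁ a t₀ q w ∨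
    ∃ w₂ w₃, IsLogIncrement g₂ a b q w₂ ∧ IsLogIncrement g₁ t₀ b q w₃ ∧ w = w₂ - w₃
  have hmix : ∀ q ∈ H, ∀ w₁ w₂ w₃, IsLogIncrement g₁ a t₀ q w₁ → IsLogIncrement g₂ a b q w₂ →
      IsLogIncrement g₁ t₀ b q w₃ → w₁ = w₂ - w₃ := by
    intro q hq w₁ w₂ w₃ h1 h2 h3
    have h13 := h1.concat hat htb hg₁ h3
    have := hcon q hq (fun t ht => h13.ne ht) _ _ h13 h2
    rw [← this]; ring
  have hRuniq : ∀ q ∈ H, ∀ w w', R q w → R q w' → w = w' := by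
    rintro q hq w w' (h1 | ⟨w₂, w₃, h2, h3, rfl⟩) (h1' | ⟨w₂', w₃', h2', h3', rfl⟩)
    · exact h1.unique hat.le h1'
    · exact hmix q hq _ _ _ h1 h2' h3'
    · exact (hmix q hq _ _ _ h1' h2 h3).symm
    · rw [h2.unique hab.le h2', h3.unique htb.le h3']
  have hRex : ∀ q ∈ H \ {z}, ∃ w, R q w := by
    rintro q ⟨hq, hqz⟩
    by_cases h1 : ∀ t ∈ Icc a t₀, g₁ t ≠ q
    · obtain ⟨w, hw⟩ := IsLogIncrement.exists_of_ne hat hg₁ h1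
      exact ⟨w, Or.inl hw⟩
    · push Not at h1
      obtain ⟨s, hs, rfl⟩ := h1
      obtain ⟨w₂, hw₂⟩ := IsLogIncrement.exists_of_ne hab hg₂ (q := g₁ s) fun t ht h =>
        h2H t ht (h ▸ hq)
      obtain ⟨w₃, hw₃⟩ := IsLogIncrement.exists_of_ne htb hg₁ (q := g₁ s) fun t ht h => by
        have hts := hinj ⟨hat.le.trans ht.1, ht.2⟩ ⟨hs.1, hs.2.trans htb.le⟩ h
        have : s = t₀ := le_antisymm hs.2 (hts ▸ ht.1)
        exact hqz (by rw [this]; rfl)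
      exact ⟨_, Or.inr ⟨w₂, w₃, hw₂, hw₃, rfl⟩⟩
  choose! G hG using hRex
  have hexp : ∀ q ∈ H \ {z}, exp (G q) = (z - q) / (x - q) := by
    intro q hq
    rcases hG q hq with h1 | ⟨w₂, w₃, h2, h3, h⟩
    · exact h1.exp_eq hat.le
    · rw [h, exp_sub, h2.exp_eq hab.le, h3.exp_eq htb.le, ← ha, ← hb]
      have h4 : y - q ≠ 0 := sub_ne_zero.2 (h3.ne (right_mem_Icc.2 htb.le))
      have h5 : z - q ≠ 0 := sub_ne_zero.2 (h3.ne (left_mem_Icc.2 htb.le))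
      have h6 : x - q ≠ 0 := sub_ne_zero.2 (by rw [ha]; exact h2.ne (left_mem_Icc.2 hab.le))
      simp only [← hy, ← hz]
      field_simp
  have hopen : IsOpen (H \ {z}) := hH.sdiff isClosed_singleton
  have hcont : ContinuousOn G (H \ {z}) := by
    intro q hq
    refine ContinuousAt.continuousWithinAt ?_
    have hxq : x - q ≠ 0 := sub_ne_zero.2 fun h => hxH (h ▸ hq.1)
    have hzq : z - q ≠ 0 := sub_ne_zero.2 fun h => hq.2 h.symm
    have hev : (fun q' => G q + (log ((z - q') / (z - q)) - log ((x - q') / (x - q)))) =ᶠ[𝓝 q] G := by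
      rcases hG q hq with h1 | ⟨w₂, w₃, h2, h3, h⟩
      · filter_upwards [h1.eventually_shift hg₁, hopen.mem_nhds hq] with q' h1' hq'
        exact hRuniq q' hq'.1 _ _ (Or.inl h1') (hG q' hq')
      · filter_upwards [h2.eventually_shift hg₂, h3.eventually_shift hg₁,
          hopen.mem_nhds hq] with q' h2' h3' hq'
        refine hRuniq q' hq'.1 _ _ (Or.inr ⟨_, _, h2', h3', ?_⟩) (hG q' hq')
        rw [h, ← ha, ← hb]
        ring
    refine ContinuousAt.congr ?_ hev
    have c1 : ContinuousAt (fun q' => log ((z - q') / (z - q))) q :=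
      ContinuousAt.clog (by fun_prop) (by simp [div_self hzq])
    have c2 : ContinuousAt (fun q' => log ((x - q') / (x - q))) q :=
      ContinuousAt.clog (by fun_prop) (by simp [div_self hxq])
    exact continuousAt_const.add (c1.sub c2)
  obtain ⟨r, hr, hball⟩ := Metric.isOpen_iff.1 hH z hzH
  have hrx : r ≤ ‖x - z‖ := by
    by_contra! h
    exact hxH (hball (by rwa [Metric.mem_ball, dist_eq_norm]))
  have hxz : x - z ≠ 0 := norm_pos_iff.1 (hr.trans_le hrx)
  have hr2 : ((r / 2 : ℝ) : ℂ) ≠ 0 := by exact_mod_cast (half_pos hr).ne'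
  let e : ℝ → ℂ := fun θ => ((r / 2 : ℝ) : ℂ) * exp (θ * I)
  have he : Continuous e := by fun_prop
  have hen : ∀ θ, ‖e θ‖ = r / 2 := fun θ => by
    simp only [e, norm_mul, norm_exp_ofReal_mul_I, norm_real, mul_one]
    exact abs_of_pos (half_pos hr)
  have hemem : ∀ θ, z + e θ ∈ H \ {z} := fun θ => by
    refine ⟨hball ?_, ?_⟩
    · rw [Metric.mem_ball, dist_eq_norm, add_sub_cancel_left, hen]; linarith
    · have : e θ ≠ 0 := mul_ne_zero hr2 (exp_ne_zero _)
      simpa using this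
  have hsl : ∀ θ, 1 + -(e θ / (x - z)) ∈ slitPlane := fun θ => by
    refine mem_slitPlane_of_norm_lt_one ?_
    rw [norm_neg, norm_div, hen, div_lt_one (norm_pos_iff.2 hxz)]
    linarith
  let Φ : ℝ → ℂ := fun θ => G (z + e θ) + log (1 + -(e θ / (x - z))) - θ * I
  have hΦ : Continuous Φ := by
    have c1 : Continuous fun θ => G (z + e θ) := hcont.comp_continuous (by fun_prop) hemem
    have c2 : Continuous fun θ => log (1 + -(e θ / (x - z))) :=
      Continuous.clog (by fun_prop) hsl
    exact (c1.add c2).sub (by fun_prop)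
  have hΦe : ∀ θ, exp (Φ θ) = -((r / 2 : ℝ) : ℂ) / (x - z) := fun θ => by
    simp only [Φ]
    rw [exp_sub, exp_add, exp_log (slitPlane_ne_zero (hsl θ)), hexp _ (hemem θ)]
    have h6 : x - (z + e θ) ≠ 0 := sub_ne_zero.2 fun h => hxH (h ▸ (hemem θ).1)
    have h7 : x - z - e θ ≠ 0 := by rwa [sub_sub]
    have h8 := exp_ne_zero (θ * I)
    have h9 : 1 + -(e θ / (x - z)) = (x - z - e θ) / (x - z) := by field_simp; ring
    rw [h9, ← sub_sub]
    have h10 : z - z - e θ = -((r / 2 : ℝ) : ℂ) * exp (θ * I) := by simp only [e]; ring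
    rw [h10]
    field_simp
    ring
  have hfin := isPreconnected_univ.eq_of_exp_eq_one (f := fun θ => Φ θ - Φ 0)
    (by fun_prop) (fun θ _ => by
      rw [exp_sub, hΦe, hΦe, div_self]
      exact div_ne_zero (neg_ne_zero.2 hr2) hxz) (mem_univ (2 * Real.pi)) (mem_univ (0 : ℝ))
  have hper : e (2 * Real.pi) = e 0 := by simp [e, exp_two_pi_mul_I]
  simp only [Φ, hper] at hfin
  have : (2 * Real.pi : ℂ) * I = 0 := by
    push_cast at hfin
    linear_combination -hfin
  simp [Real.pi_ne_zero] at this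

/-- A `1`-Lipschitz curve whose endpoints are at maximal distance covers the segment between
them. -/
lemma eq_lineMap_of_dist_eq {F P : Type*} [NormedAddCommGroup F] [NormedSpace ℝ F]
    [StrictConvexSpace ℝ F] [MetricSpace P] [NormedAddTorsor F P] {g : ℝ → P} {s t r : ℝ}
    {A : Set ℝ} (hA : Convex ℝ A) (hs : s ∈ A) (ht : t ∈ A) (hr : r ∈ Icc (0 : ℝ) 1)
    (hlip : ∀ u ∈ A, ∀ v ∈ A, dist (g u) (g v) ≤ |u - v|) (hd : dist (g s) (g t) = |s - t|) :
    AffineMap.lineMap s t r ∈ A ∧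
      g (AffineMap.lineMap s t r) = AffineMap.lineMap (g s) (g t) r := by
  have hm : AffineMap.lineMap s t r ∈ A := hA.lineMap_mem hs ht hr
  have h1 := hlip s hs _ hm
  have h2 := hlip _ hm t ht
  have h3 := dist_triangle (g s) (g (AffineMap.lineMap s t r)) (g t)
  have e1 : |s - AffineMap.lineMap s t r| = r * |s - t| := by
    rw [← Real.dist_eq, dist_left_lineMap, Real.norm_of_nonneg hr.1, Real.dist_eq]
  have e2 : |AffineMap.lineMap s t r - t| = (1 - r) * |s - t| := by
    rw [← Real.dist_eq, dist_lineMap_right, Real.norm_of_nonneg (sub_nonneg.2 hr.2), Real.dist_eq]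
  rw [e1] at h1
  rw [e2] at h2
  refine ⟨hm, eq_lineMap_of_dist_eq_mul_of_dist_eq_mul ?_ ?_⟩ <;> rw [hd] at * <;> nlinarith

/-- Two arcs in `S ⊆ ℂ` with common endpoints, each of which is the shortest curve in `S` between
any two of its points at least as far as straight segments are concerned, such that the closed
curve they form has winding number zero about each point outside `S`. -/
structure IsBigon (S : Set ℂ) (g₁ g₂ : ℝ → ℂ) (a b : ℝ) : Prop where
  lt : a < b
  cont₁ : Continuous g₁
  cont₂ : Continuous g₂
  left : g₁ a = g₂ a
  right : g₁ b = g₂ b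
  inj₁ : InjOn g₁ (Icc a b)
  inj₂ : InjOn g₂ (Icc a b)
  disj : ∀ s ∈ Icc a b, ∀ t ∈ Icc a b, g₁ s = g₂ t → s = a ∨ s = b
  mem₁ : ∀ t ∈ Icc a b, g₁ t ∈ S
  mem₂ : ∀ t ∈ Icc a b, g₂ t ∈ S
  lip₁ : ∀ s ∈ Icc a b, ∀ t ∈ Icc a b, dist (g₁ s) (g₁ t) ≤ |s - t|
  lip₂ : ∀ s ∈ Icc a b, ∀ t ∈ Icc a b, dist (g₂ s) (g₂ t) ≤ |s - t|
  geo₁ : ∀ s ∈ Icc a b, ∀ t ∈ Icc a b, segment ℝ (g₁ s) (g₁ t) ⊆ S → dist (g₁ s) (g₁ t) = |s - t|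
  geo₂ : ∀ s ∈ Icc a b, ∀ t ∈ Icc a b, segment ℝ (g₂ s) (g₂ t) ⊆ S → dist (g₂ s) (g₂ t) = |s - t|
  triv : ∀ p ∉ S, ∀ w₁ w₂, IsLogIncrement g₁ a b p w₁ → IsLogIncrement g₂ a b p w₂ → w₁ = w₂

namespace IsBigon

variable {S : Set ℂ} {g₁ g₂ : ℝ → ℂ} {a b : ℝ}

lemma symm (h : IsBigon S g₁ g₂ a b) : IsBigon S g₂ g₁ a b where
  lt := h.lt
  cont₁ := h.cont₂
  cont₂ := h.cont₁
  left := h.left.symm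
  right := h.right.symm
  inj₁ := h.inj₂
  inj₂ := h.inj₁
  disj s hs t ht hst := by
    rcases h.disj t ht s hs hst.symm with rfl | rfl
    · exact Or.inl (h.inj₂ hs ht (hst.trans h.left))
    · exact Or.inr (h.inj₂ hs ht (hst.trans h.right))
  mem₁ := h.mem₂
  mem₂ := h.mem₁
  lip₁ := h.lip₂
  lip₂ := h.lip₁
  geo₁ := h.geo₂
  geo₂ := h.geo₁
  triv p hp w₁ w₂ h₁ h₂ := (h.triv p hp w₂ w₁ h₂ h₁).symm

/-- A point about which the bigon winds sees only bigon or points of `S` in each direction. -/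
lemma ne_of_segment (h : IsBigon S g₁ g₂ a b) {q p w₁ w₂ : ℂ}
    (h₁ : IsLogIncrement g₁ a b q w₁) (h₂ : IsLogIncrement g₂ a b q w₂) (hne : w₁ ≠ w₂)
    (hs₁ : ∀ t ∈ Icc a b, g₁ t ∉ segment ℝ q p) (hs₂ : ∀ t ∈ Icc a b, g₂ t ∉ segment ℝ q p) :
    p ∈ S ∧ ∃ t ∈ Icc a b, dist (g₁ a) p ≤ dist (g₁ t) (g₁ a) ∨
      dist (g₁ a) p ≤ dist (g₂ t) (g₁ a) := by
  have k₁ := h₁.shift h.cont₁ hs₁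
  have k₂ := h₂.shift h.cont₂ hs₂
  rw [h.left, h.right] at k₁
  constructor
  · by_contra hp
    exact hne (add_right_cancel (h.triv p hp _ _ k₁ k₂))
  · by_contra! hcon
    have l₁ := IsLogIncrement.of_far h.lt.le h.cont₁ fun t ht => (hcon t ht).1
    have l₂ := IsLogIncrement.of_far h.lt.le h.cont₂ fun t ht => by
      rw [← h.left]; exact (hcon t ht).2
    rw [h.left, h.right] at l₁
    have := (k₁.unique h.lt.le l₁).trans (k₂.unique h.lt.le l₂).symm
    exact hne (add_right_cancel this)

lemma exists_hit (h : IsBigon S g₁ g₂ a b) {f : ℂ →L[ℝ] ℝ} {c : ℝ} {q v w₁ w₂ : ℂ}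
    (hf₂ : ∀ t ∈ Icc a b, f (g₂ t) < c) (hq : c < f q) (hv : v ≠ 0) (hfv : f v = 0)
    (h₁ : IsLogIncrement g₁ a b q w₁) (h₂ : IsLogIncrement g₂ a b q w₂) (hne : w₁ ≠ w₂) :
    ∃ s : ℝ, 0 < s ∧ (∃ t ∈ Icc a b, g₁ t = q + s • v) ∧ ∀ r ∈ Icc 0 s, q + r • v ∈ S := by
  let K : Set ℝ := Ici 0 ∩ (fun s : ℝ => q + s • v) ⁻¹' (g₁ '' Icc a b)
  have hK : IsClosed K := isClosed_Ici.inter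
    ((isCompact_Icc.image h.cont₁).isClosed.preimage (by fun_prop))
  have hseg : ∀ s : ℝ, 0 ≤ s → ∀ u ∈ segment ℝ q (q + s • v), ∃ r ∈ Icc 0 s, u = q + r • v := by
    intro s hs u hu
    rw [segment_eq_image'] at hu
    obtain ⟨θ, hθ, rfl⟩ := hu
    refine ⟨θ * s, ⟨mul_nonneg hθ.1 hs, by nlinarith [hθ.2]⟩, ?_⟩
    simp [mul_assoc]
  have hs₂ : ∀ s : ℝ, 0 ≤ s → ∀ t ∈ Icc a b, g₂ t ∉ segment ℝ q (q + s • v) := by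
    intro s hs t ht hu
    obtain ⟨r, -, hr⟩ := hseg s hs _ hu
    have := hf₂ t ht
    rw [hr, map_add, map_smul, hfv] at this
    simp at this
    linarith
  have hnon : K.Nonempty := by
    by_contra hcon
    rw [not_nonempty_iff_eq_empty] at hcon
    have hs₁ : ∀ s : ℝ, 0 ≤ s → ∀ t ∈ Icc a b, g₁ t ∉ segment ℝ q (q + s • v) := by
      intro s hs t ht hu
      obtain ⟨r, hr, hr'⟩ := hseg s hs _ hu
      exact (hcon ▸ (⟨hr.1, t, ht, hr'⟩ : r ∈ K) : r ∈ (∅ : Set ℝ))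
    have hbdd : Bornology.IsBounded (g₁ '' Icc a b ∪ g₂ '' Icc a b) :=
      ((isCompact_Icc.image h.cont₁).union (isCompact_Icc.image h.cont₂)).isBounded
    obtain ⟨M, hM⟩ := hbdd.subset_closedBall (g₁ a)
    have hM0 : 0 ≤ M := by
      have := hM (Or.inl ⟨a, left_mem_Icc.2 h.lt.le, rfl⟩)
      simpa using this
    have hvpos := norm_pos_iff.2 hv
    set s := (M + 1 + dist (g₁ a) q) / ‖v‖ with hsdef
    have hs0 : 0 ≤ s := by positivity
    obtain ⟨t, ht, htt⟩ := (h.ne_of_segment h₁ h₂ hne (hs₁ s hs0) (hs₂ s hs0)).2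
    have hlt : M < dist (g₁ a) (q + s • v) := by
      have h3 := dist_triangle_left q (q + s • v) (g₁ a)
      have h4 : dist q (q + s • v) = M + 1 + dist (g₁ a) q := by
        rw [dist_self_add_right, norm_smul, Real.norm_of_nonneg hs0, hsdef]
        field_simp
      linarith
    rcases htt with htt | htt
    · exact absurd (hM (Or.inl ⟨t, ht, rfl⟩)) (by
        rw [Metric.mem_closedBall]; linarith)
    · exact absurd (hM (Or.inr ⟨t, ht, rfl⟩)) (by
        rw [Metric.mem_closedBall]; linarith)
  have hbelow : BddBelow K := ⟨0, fun s hs => hs.1⟩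
  have hmem := hK.csInf_mem hnon hbelow
  obtain ⟨hs0, t, ht, hts⟩ := hmem
  refine ⟨sInf K, lt_of_le_of_ne hs0 fun h0 => ?_, ⟨t, ht, hts⟩, fun r hr => ?_⟩
  · rw [← h0] at hts
    exact h₁.ne ht (by simpa using hts)
  · rcases hr.2.eq_or_lt with rfl | hlt
    · rw [show q + sInf K • v = g₁ t from hts.symm]
      exact h.mem₁ t ht
    · refine (h.ne_of_segment h₁ h₂ hne ?_ (hs₂ r hr.1)).1
      intro t' ht' hu
      obtain ⟨r', hr', hr''⟩ := hseg r hr.1 _ hu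
      have := csInf_le hbelow (⟨hr'.1, t', ht', hr''⟩ : r' ∈ K)
      linarith [hr'.2]

lemma not_separated (h : IsBigon S g₁ g₂ a b) {f : ℂ →L[ℝ] ℝ} {c t₀ : ℝ} (ht₀ : t₀ ∈ Icc a b)
    (hf₁ : c < f (g₁ t₀)) (hf₂ : ∀ t ∈ Icc a b, f (g₂ t) < c) : False := by
  have hla := left_mem_Icc.2 h.lt.le
  have hlb := right_mem_Icc.2 h.lt.le
  have hat : a < t₀ := lt_of_le_of_ne ht₀.1 fun e => by
    have := hf₂ a hla
    rw [← h.left, e] at this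
    linarith
  have htb : t₀ < b := lt_of_le_of_ne ht₀.2 fun e => by
    have := hf₂ b hlb
    rw [← h.right, ← e] at this
    linarith
  obtain ⟨q, hq, hqne, w₁, w₂, h₁, h₂, hne⟩ := exists_isLogIncrement_ne h.cont₁ h.cont₂ hat htb
    h.inj₁ h.left h.right (H := {u | c < f u}) (isOpen_lt continuous_const f.continuous) hf₁
    fun t ht => not_lt.2 (hf₂ t ht).le
  obtain ⟨v, hv, hfv⟩ : ∃ v : ℂ, v ≠ 0 ∧ f v = 0 := by
    by_cases h1 : f 1 = 0
    · exact ⟨1, one_ne_zero, h1⟩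
    · refine ⟨f I • 1 - f 1 • I, fun h0 => h1 ?_, ?_⟩
      · have := congrArg Complex.im h0
        simpa using this
      · rw [map_sub, map_smul, map_smul, smul_eq_mul, smul_eq_mul]; ring
  obtain ⟨s, hs, ⟨t, ht, hts⟩, hsS⟩ := h.exists_hit hf₂ hq hv hfv h₁ h₂ hne
  obtain ⟨s', hs', ⟨t', ht', hts'⟩, hsS'⟩ := h.exists_hit hf₂ hq (neg_ne_zero.2 hv)
    (by rw [map_neg, hfv, neg_zero]) h₁ h₂ hne
  have hsub : segment ℝ (g₁ t) (g₁ t') ⊆ S := by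
    intro u hu
    rw [segment_eq_image'] at hu
    obtain ⟨θ, hθ, rfl⟩ := hu
    have e : g₁ t + θ • (g₁ t' - g₁ t) = q + (s - θ * (s + s')) • v := by
      rw [hts, hts']; module
    simp only [e]
    rcases le_total 0 (s - θ * (s + s')) with h0 | h0
    · exact hsS _ ⟨h0, by nlinarith [hθ.1]⟩
    · have := hsS' (-(s - θ * (s + s'))) ⟨by linarith, by nlinarith [hθ.2]⟩
      convert this using 1
      module
  have hd := h.geo₁ t ht t' ht' hsub
  have hss : 0 < s + s' := add_pos hs hs'
  have hr : s / (s + s') ∈ Icc (0 : ℝ) 1 :=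
    ⟨by positivity, (div_le_one hss).2 (by linarith)⟩
  obtain ⟨hm, heq⟩ := eq_lineMap_of_dist_eq (convex_Icc a b) ht ht' hr h.lip₁ hd
  refine hqne _ hm (heq.trans ?_)
  rw [AffineMap.lineMap_apply_module', hts, hts']
  have : s / (s + s') * (s + s') = s := by field_simp
  have e : (s / (s + s')) • (q + s' • -v - (q + s • v)) + (q + s • v) =
      q + (s - s / (s + s') * (s + s')) • v := by module
  rw [e, this]
  simp

lemma not_strictMax (h : IsBigon S g₁ g₂ a b) (f : ℂ →L[ℝ] ℝ) {s : ℝ} (hs : s ∈ Icc a b)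
    (hsa : s ≠ a) (hsb : s ≠ b)
    (hmax : ∀ t ∈ Icc a b, ‖g₂ t‖ ^ 2 + f (g₂ t) ≤ ‖g₁ s‖ ^ 2 + f (g₁ s)) : False := by
  let l : ℂ →L[ℝ] ℝ := (2 : ℝ) • innerSL ℝ (g₁ s) + f
  have hl : ∀ p, l p = 2 * inner ℝ (g₁ s) p + f p := fun p => rfl
  have hlt : ∀ t ∈ Icc a b, l (g₂ t) < l (g₁ s) := by
    intro t ht
    have hne : g₁ s ≠ g₂ t := fun e => (h.disj s hs t ht e).elim hsa hsb
    have h1 := hmax t ht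
    have h2 := norm_sub_sq_real (g₂ t) (g₁ s)
    have h3 : 0 < ‖g₂ t - g₁ s‖ := norm_pos_iff.2 (sub_ne_zero.2 hne.symm)
    have h4 := real_inner_self_eq_norm_sq (g₁ s)
    rw [real_inner_comm] at h2
    rw [hl, hl, h4]
    nlinarith [sq_pos_of_pos h3]
  obtain ⟨t, ht, htmax⟩ := isCompact_Icc.exists_isMaxOn (nonempty_Icc.2 h.lt.le)
    (l.continuous.comp h.cont₂).continuousOn
  obtain ⟨c, hc₁, hc₂⟩ := exists_between (hlt t ht)
  exact h.not_separated hs hc₂ fun t' ht' => (htmax ht').trans_lt hc₁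

lemma mem_segment (h : IsBigon S g₁ g₂ a b) {t : ℝ} (ht : t ∈ Icc a b) :
    g₁ t ∈ segment ℝ (g₁ a) (g₁ b) := by
  by_contra hcon
  have hla := left_mem_Icc.2 h.lt.le
  have hlb := right_mem_Icc.2 h.lt.le
  have hsegc : IsClosed (segment ℝ (g₁ a) (g₁ b)) := by
    rw [segment_eq_image_lineMap]
    exact (isCompact_Icc.image AffineMap.lineMap_continuous).isClosed
  obtain ⟨f, c, hf, hc⟩ :=
    geometric_hahn_banach_closed_point (convex_segment (g₁ a) (g₁ b)) hsegc hcon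
  have hfa := hf _ (left_mem_segment ℝ _ _)
  have hfb := hf _ (right_mem_segment ℝ _ _)
  obtain ⟨M, hM⟩ : ∃ M : ℝ, M * (f (g₁ t) - c) = ‖g₁ a‖ ^ 2 + ‖g₁ b‖ ^ 2 :=
    ⟨(‖g₁ a‖ ^ 2 + ‖g₁ b‖ ^ 2) / (f (g₁ t) - c), div_mul_cancel₀ _ (sub_pos.2 hc).ne'⟩
  have hM0 : 0 ≤ M := nonneg_of_mul_nonneg_left (hM ▸ by positivity) (sub_pos.2 hc)
  let F : ℂ → ℝ := fun p => ‖p‖ ^ 2 + ((M + 1) • f) p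
  have hF : Continuous F := by
    have := ((M + 1) • f).continuous
    exact (continuous_norm.pow 2).add this
  have hFa : F (g₁ a) < F (g₁ t) := by
    simp only [F, _root_.smul_apply, smul_eq_mul]
    nlinarith [sq_nonneg ‖g₁ b‖, sq_nonneg ‖g₁ t‖]
  have hFb : F (g₁ b) < F (g₁ t) := by
    simp only [F, _root_.smul_apply, smul_eq_mul]
    nlinarith [sq_nonneg ‖g₁ a‖, sq_nonneg ‖g₁ t‖]
  obtain ⟨w, hw, hwmax⟩ := ((isCompact_Icc.image h.cont₁).union
    (isCompact_Icc.image h.cont₂)).exists_isMaxOn ⟨_, Or.inl ⟨t, ht, rfl⟩⟩ hF.continuousOn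
  have hmax₁ : ∀ s ∈ Icc a b, F (g₁ s) ≤ F w := fun s hs => hwmax (Or.inl ⟨s, hs, rfl⟩)
  have hmax₂ : ∀ s ∈ Icc a b, F (g₂ s) ≤ F w := fun s hs => hwmax (Or.inr ⟨s, hs, rfl⟩)
  have hwa : w ≠ g₁ a := fun e => absurd (hmax₁ t ht) (by rw [e]; exact not_le.2 hFa)
  have hwb : w ≠ g₁ b := fun e => absurd (hmax₁ t ht) (by rw [e]; exact not_le.2 hFb)
  rcases hw with ⟨s, hs, rfl⟩ | ⟨s, hs, rfl⟩
  · exact h.not_strictMax _ hs (fun e => hwa (by rw [e])) (fun e => hwb (by rw [e])) hmax₂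
  · exact h.symm.not_strictMax _ hs (fun e => hwa (by rw [e, h.left]))
      (fun e => hwb (by rw [e, h.right])) hmax₁

end IsBigon

theorem not_isBigon {S : Set ℂ} {g₁ g₂ : ℝ → ℂ} {a b : ℝ} : ¬ IsBigon S g₁ g₂ a b := by
  intro h
  have hla := left_mem_Icc.2 h.lt.le
  have hlb := right_mem_Icc.2 h.lt.le
  have hne : g₁ b - g₁ a ≠ 0 := sub_ne_zero.2 fun e => h.lt.ne' (h.inj₁ hlb hla e)
  have hsS : segment ℝ (g₁ a) (g₁ b) ⊆ S := by
    let φ : ℂ → ℝ := fun u => ((u - g₁ a) / (g₁ b - g₁ a)).re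
    have hφ : ContinuousOn (φ ∘ g₁) (Icc a b) := by
      have := h.cont₁
      exact Continuous.continuousOn (by simp only [φ, Function.comp_def]; fun_prop)
    have hφl : ∀ r : ℝ, φ (AffineMap.lineMap (g₁ a) (g₁ b) r) = r := fun r => by
      simp only [φ, AffineMap.lineMap_apply_module', add_sub_cancel_right, real_smul]
      rw [mul_div_cancel_right₀ _ hne, ofReal_re]
    have hivt := intermediate_value_Icc h.lt.le hφ
    have e0 : (φ ∘ g₁) a = 0 := by simp [φ]
    have e1 : (φ ∘ g₁) b = 1 := by simp [φ, div_self hne]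
    rw [e0, e1] at hivt
    rw [segment_eq_image_lineMap]
    rintro _ ⟨r, hr, rfl⟩
    obtain ⟨t, ht, htr⟩ := hivt hr
    have := h.mem_segment ht
    rw [segment_eq_image_lineMap] at this
    obtain ⟨r', -, hr'⟩ := this
    have : r' = r := by rw [← hφl r', hr']; exact htr
    rw [← this, hr']
    exact h.mem₁ t ht
  have hd₁ := h.geo₁ a hla b hlb hsS
  have hd₂ := h.geo₂ a hla b hlb (by rwa [← h.left, ← h.right])
  have hr : (1 / 2 : ℝ) ∈ Icc (0 : ℝ) 1 := by norm_num
  obtain ⟨hm, k₁⟩ := eq_lineMap_of_dist_eq (convex_Icc a b) hla hlb hr h.lip₁ hd₁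
  obtain ⟨-, k₂⟩ := eq_lineMap_of_dist_eq (convex_Icc a b) hla hlb hr h.lip₂ hd₂
  rw [← h.left, ← h.right] at k₂
  have hlt := h.lt
  rcases h.disj _ hm _ hm (k₁.trans k₂.symm) with e | e <;>
  · rw [AffineMap.lineMap_apply_module'] at e
    simp only [smul_eq_mul] at e
    linarith

end Winding

section Existence

open Topology Filter
open scoped NNReal ENNReal unitInterval

section PathMetric

variable {X : Type*} [PseudoEMetricSpace X] {x y z : X}

lemma pathLength_le_of_lipschitzWith {K : ℝ≥0} (c : Path x y) (hc : LipschitzWith K c) :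
    pathLength c ≤ K := by
  have h1 : eVariationOn (fun t : I => (t : ℝ)) univ ≤ 1 := by
    have h := (MonotoneOn.eVariationOn_eq (f := fun t : I => (t : ℝ)) (s := univ)
      (fun _ _ _ _ h => h) (mem_univ 0) (mem_univ 1)).le
    have hu : (univ : Set I) ∩ Icc 0 1 = univ := by
      exact (univ_inter _).trans (eq_univ_of_forall fun t => ⟨t.2.1, t.2.2⟩)
    rw [hu] at h
    simpa using h
  have h2 : eVariationOn (c ∘ id) univ ≤ K * eVariationOn (id : I → I) univ :=
    (hc.lipschitzOnWith (s := univ)).comp_eVariationOn_le (mapsTo_univ _ _)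
  calc pathLength c ≤ K * eVariationOn (fun t : I => (t : ℝ)) univ := h2
    _ ≤ K * 1 := by gcongr
    _ = K := mul_one _

lemma edist_le_pathEDist (x y : X) : edist x y ≤ pathEDist x y := by
  refine le_iInf fun c => ?_
  have := eVariationOn.edist_le (fun t : I => c t) (mem_univ 0) (mem_univ 1)
  rwa [c.source, c.target] at this

lemma pathEDist_comm (x y : X) : pathEDist x y = pathEDist y x := by
  have key : ∀ x y : X, pathEDist x y ≤ pathEDist y x := fun x y => by
    refine le_iInf fun c => (iInf_le _ c.symm).trans ?_
    exact eVariationOn.comp_le_of_antitoneOn (fun t : I => c t) (s := univ) (t := univ) σ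
      (fun _ _ _ _ h => unitInterval.symm_le_symm.2 h) (mapsTo_univ _ _)
  exact le_antisymm (key x y) (key y x)

lemma pathLength_trans_le (c : Path x y) (c' : Path y z) :
    pathLength (c.trans c') ≤ pathLength c + pathLength c' := by
  let m : I := ⟨1 / 2, by norm_num, by norm_num⟩
  have hu : (univ : Set I) = Iic m ∪ Ici m := Iic_union_Ici.symm
  unfold pathLength
  rw [hu, eVariationOn.union _ isGreatest_Iic isLeast_Ici, ← hu]
  gcongr
  · have e : EqOn (fun t : I => c.trans c' t)
        ((fun t : I => c t) ∘ fun t => projIcc 0 1 zero_le_one (2 * (t : ℝ))) (Iic m) := by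
      intro t ht
      have ht' : (t : ℝ) ≤ 1 / 2 := ht
      simp only [Path.trans_apply, ht', dif_pos, Function.comp_apply]
      rw [projIcc_of_mem zero_le_one (⟨by linarith [t.2.1], by linarith⟩ : 2 * (t : ℝ) ∈ Icc 0 1)]
    rw [eVariationOn.congr e]
    refine eVariationOn.comp_le_of_monotoneOn _ _ (fun s _ t _ hst => ?_) (mapsTo_univ _ _)
    exact monotone_projIcc _ (mul_le_mul_of_nonneg_left (show (s : ℝ) ≤ t from hst) zero_le_two)
  · have e : EqOn (fun t : I => c.trans c' t)
        ((fun t : I => c' t) ∘ fun t => projIcc 0 1 zero_le_one (2 * (t : ℝ) - 1)) (Ici m) := by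
      intro t ht
      have ht' : (1 / 2 : ℝ) ≤ t := ht
      simp only [Path.trans_apply, Function.comp_apply]
      rw [projIcc_of_mem zero_le_one
        (⟨by linarith, by linarith [t.2.2]⟩ : 2 * (t : ℝ) - 1 ∈ Icc 0 1)]
      split_ifs with h
      · have h' : (t : ℝ) = 1 / 2 := le_antisymm h ht'
        have e1 : (⟨2 * (t : ℝ), (unitInterval.mul_pos_mem_iff zero_lt_two).2 ⟨t.2.1, h⟩⟩ : I)
            = 1 := Subtype.ext (by simp [h'])
        have e2 : (⟨2 * (t : ℝ) - 1, ⟨by linarith, by linarith [t.2.2]⟩⟩ : I)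
            = 0 := Subtype.ext (by simp [h'])
        rw [e1, e2, c.target, c'.source]
      · rfl
    rw [eVariationOn.congr e]
    refine eVariationOn.comp_le_of_monotoneOn _ _ (fun s _ t _ hst => ?_) (mapsTo_univ _ _)
    exact monotone_projIcc _ (sub_le_sub_right
      (mul_le_mul_of_nonneg_left (show (s : ℝ) ≤ t from hst) zero_le_two) 1)

lemma pathEDist_triangle (x y z : X) : pathEDist x z ≤ pathEDist x y + pathEDist y z := by
  unfold pathEDist
  simp_rw [ENNReal.iInf_add, ENNReal.add_iInf]
  exact le_iInf fun c => le_iInf fun c' => (iInf_le _ (c.trans c')).trans (pathLength_trans_le c c')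

end PathMetric

section Lipschitz

variable {X : Type*} [MetricSpace X] {x y : X}

lemma pathEDist_le_of_dist_le {A : Set ℝ} (hA : Convex ℝ A) {g : ℝ → X}
    (hg : ∀ s ∈ A, ∀ t ∈ A, dist (g s) (g t) ≤ |s - t|) {s t : ℝ} (hs : s ∈ A) (ht : t ∈ A) :
    pathEDist (g s) (g t) ≤ ENNReal.ofReal |s - t| := by
  let f : I → X := fun τ => g (AffineMap.lineMap s t (τ : ℝ))
  have hm : ∀ τ : I, AffineMap.lineMap s t (τ : ℝ) ∈ A := fun τ => hA.lineMap_mem hs ht τ.2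
  have hf : LipschitzWith (Real.toNNReal |s - t|) f := LipschitzWith.of_dist_le_mul fun τ τ' => by
    refine (hg _ (hm τ) _ (hm τ')).trans_eq ?_
    rw [← Real.dist_eq, dist_lineMap_lineMap, Real.coe_toNNReal _ (abs_nonneg _), mul_comm,
      ← Real.dist_eq]
    rfl
  let c : Path (g s) (g t) := ⟨⟨f, hf.continuous⟩, by simp [f], by simp [f]⟩
  exact (iInf_le _ c).trans (pathLength_le_of_lipschitzWith c hf)

/-- A rectifiable path has a `1`-Lipschitz reparametrization. -/
lemma exists_reparametrization (c : Path x y) (hc : pathLength c ≠ ⊤) :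
    ∃ g : ℝ → X, g 0 = x ∧ g (pathLength c).toReal = y ∧
      ∀ s ∈ Ici (0 : ℝ), ∀ t ∈ Ici (0 : ℝ), dist (g s) (g t) ≤ |s - t| := by
  let V : I → ℝ := fun t => (eVariationOn (fun t : I => c t) (Iic t)).toReal
  have hfin : ∀ A : Set I, eVariationOn (fun t : I => c t) A ≠ ⊤ := fun A =>
    ne_top_of_le_ne_top hc (eVariationOn.mono _ (subset_univ A))
  have hV : ∀ τ τ' : I, τ ≤ τ' → dist (c τ) (c τ') ≤ V τ' - V τ := by
    intro τ τ' h
    have h1 : eVariationOn (fun t : I => c t) (Iic τ) + edist (c τ) (c τ') ≤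
        eVariationOn (fun t : I => c t) (Iic τ') := by
      have h2 := eVariationOn.add_le_union (fun t : I => c t) (s := Iic τ) (t := Icc τ τ')
        fun u hu v hv => le_trans hu hv.1
      rw [Iic_union_Icc_eq_Iic h] at h2
      refine le_trans ?_ h2
      gcongr
      exact eVariationOn.edist_le _ (left_mem_Icc.2 h) (right_mem_Icc.2 h)
    have h3 := ENNReal.toReal_mono (hfin _) h1
    rw [ENNReal.toReal_add (hfin _) (edist_ne_top _ _), ← dist_edist] at h3
    simp only [V]
    linarith
  have hV0 : V 0 = 0 := by
    have : (Iic (0 : I)).Subsingleton := fun u hu v hv =>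
      (le_antisymm hu bot_le).trans (le_antisymm hv bot_le).symm
    simp [V, eVariationOn.subsingleton _ this]
  let T : ℝ → I := fun s => sSup {t | V t ≤ s}
  have hT1 : ∀ s τ, T s < τ → s < V τ := fun s τ h => by
    by_contra! h'
    exact absurd (le_sSup (show τ ∈ {t | V t ≤ s} from h')) (not_le.2 h)
  have hVmono : Monotone V := fun τ τ' h => by
    linarith [hV τ τ' h, dist_nonneg (x := c τ) (y := c τ')]
  have hT2 : ∀ s τ, τ < T s → V τ ≤ s := fun s τ h => by
    obtain ⟨t, ht, hlt⟩ := lt_sSup_iff.1 h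
    exact (hVmono hlt.le).trans ht
  have hcl : ∀ r : ℝ, IsClosed {p : I × I | dist (c p.1) (c p.2) ≤ r} := fun r =>
    isClosed_le (by fun_prop) continuous_const
  have hle : ∀ s t : ℝ, s ≤ t → dist (c (T s)) (c (T t)) ≤ t - s := by
    intro s t hst
    have hTT : T s ≤ T t := sSup_le_sSup fun u hu => le_trans hu hst
    rcases hTT.eq_or_lt with h | h
    · rw [h, dist_self]; linarith
    · obtain ⟨m, hm1, hm2⟩ := exists_between h
      have hsub : Ioo (T s) m ×ˢ Ioo m (T t) ⊆ {p : I × I | dist (c p.1) (c p.2) ≤ t - s} := by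
        rintro ⟨τ, τ'⟩ ⟨h1, h2⟩
        have := hV τ τ' (h1.2.trans h2.1).le
        have h3 := hT1 s τ h1.1
        have h4 := hT2 t τ' h2.2
        simp only [mem_ofPred_eq]
        linarith
      have := closure_minimal hsub (hcl _)
      rw [closure_prod_eq, closure_Ioo hm1.ne, closure_Ioo hm2.ne] at this
      exact this (mk_mem_prod (left_mem_Icc.2 hm1.le) (right_mem_Icc.2 hm2.le))
  refine ⟨fun s => c (T s), ?_, ?_, ?_⟩
  · have h0 : dist (c 0) (c (T 0)) ≤ 0 := by
      rcases (show (0 : I) ≤ T 0 from bot_le).eq_or_lt with h | h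
      · rw [← h, dist_self]
      · have hsub : ({0} : Set I) ×ˢ Ico 0 (T 0) ⊆ {p : I × I | dist (c p.1) (c p.2) ≤ 0} := by
          rintro ⟨τ, τ'⟩ ⟨rfl, h2⟩
          have := hV 0 τ' h2.1
          have h4 := hT2 0 τ' h2.2
          simp only [mem_ofPred_eq]
          linarith
        have := closure_minimal hsub (hcl _)
        rw [closure_prod_eq, closure_Ico h.ne] at this
        exact this (mk_mem_prod (subset_closure rfl) (right_mem_Icc.2 h.le))
    have := dist_le_zero.1 h0
    rw [c.source] at this
    exact this.symm
  · have : T (pathLength c).toReal = 1 := le_antisymm le_top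
      (le_sSup (ENNReal.toReal_mono hc (eVariationOn.mono _ (subset_univ _))))
    simp [this]
  · intro s _ t _
    rcases le_total s t with h | h
    · rw [abs_sub_comm, abs_of_nonneg (sub_nonneg.2 h)]
      exact hle s t h
    · rw [abs_of_nonneg (sub_nonneg.2 h), dist_comm]
      exact hle t s h

lemma exists_lipschitz_limit [ProperSpace X] {D : ℝ} (hD : 0 ≤ D)
    (h : ∀ ε > 0, ∃ g : ℝ → X, ∃ l, 0 ≤ l ∧ |l - D| < ε ∧ g 0 = x ∧ g l = y ∧
      ∀ s ∈ Ici (0 : ℝ), ∀ t ∈ Ici (0 : ℝ), dist (g s) (g t) ≤ |s - t|) :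
    ∃ g : ℝ → X, g 0 = x ∧ g D = y ∧
      ∀ s ∈ Ici (0 : ℝ), ∀ t ∈ Ici (0 : ℝ), dist (g s) (g t) ≤ |s - t| := by
  choose g l hl hlD hg0 hgl hlip using fun n : ℕ => h (1 / ((n : ℝ) + 1)) (by positivity)
  let U : Ultrafilter ℕ := hyperfilter ℕ
  have hlim : ∀ s : ℝ, 0 ≤ s → ∃ z, Tendsto (fun n => g n s) U (𝓝 z) := by
    intro s hs
    have hmem : ∀ n, g n s ∈ Metric.closedBall x s := fun n => by
      have := hlip n s hs 0 self_mem_Ici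
      rwa [hg0, sub_zero, abs_of_nonneg hs] at this
    obtain ⟨z, -, hz⟩ := (isCompact_closedBall x s).ultrafilter_le_nhds
      (U.map fun n => g n s) (by
        rw [le_principal_iff]
        exact mem_map.2 (univ_mem' hmem))
    exact ⟨z, hz⟩
  have : Nonempty X := ⟨x⟩
  choose! G hG using hlim
  refine ⟨G, ?_, ?_, ?_⟩
  · refine tendsto_nhds_unique (hG 0 le_rfl) ?_
    simp only [hg0]
    exact tendsto_const_nhds
  · have h1 : Tendsto (fun n => dist (g n D) y) U (𝓝 0) := by
      refine Tendsto.mono_left ?_ Nat.hyperfilter_le_atTop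
      refine squeeze_zero (fun _ => dist_nonneg) (fun n => ?_) tendsto_one_div_add_atTop_nhds_zero_nat
      have := hlip n D hD (l n) (hl n)
      rw [hgl, abs_sub_comm] at this
      exact this.trans (hlD n).le
    exact tendsto_nhds_unique (hG D hD) (tendsto_iff_dist_tendsto_zero.2 h1)
  · intro s hs t ht
    exact le_of_tendsto ((hG s hs).dist (hG t ht)) (Eventually.of_forall fun n => hlip n s hs t ht)

theorem exists_isGeodesicSegment [ProperSpace X] (hxy : pathEDist x y ≠ ⊤) :
    ∃ γ : ℝ → X, IsGeodesicSegment γ (pathEDist x y).toReal x y := by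
  obtain ⟨g, hg0, hgD, hlip⟩ := exists_lipschitz_limit (x := x) (y := y)
    (D := (pathEDist x y).toReal) ENNReal.toReal_nonneg fun ε hε => by
      have hlt : pathEDist x y < pathEDist x y + ENNReal.ofReal ε :=
        ENNReal.lt_add_right hxy (by simpa using hε)
      obtain ⟨c, hc⟩ := iInf_lt_iff.1 hlt
      have hctop : pathLength c ≠ ⊤ := hc.ne_top
      obtain ⟨g, hg0, hgl, hlip⟩ := exists_reparametrization c hctop
      refine ⟨g, (pathLength c).toReal, ENNReal.toReal_nonneg, ?_, hg0, hgl, hlip⟩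
      have h1 := ENNReal.toReal_mono hctop (iInf_le (fun c : Path x y => pathLength c) c)
      have h2 := (ENNReal.toReal_lt_toReal hctop (by simp [hxy])).2 hc
      rw [ENNReal.toReal_add hxy ENNReal.ofReal_ne_top, ENNReal.toReal_ofReal hε.le] at h2
      rw [abs_lt]
      constructor
      · change (pathEDist x y).toReal ≤ _ at h1
        linarith
      · linarith
  set D := (pathEDist x y).toReal with hD
  have hle : ∀ s ∈ Icc 0 D, ∀ t ∈ Icc 0 D, pathEDist (g s) (g t) ≤ ENNReal.ofReal |s - t| :=
    fun s hs t ht => pathEDist_le_of_dist_le (convex_Ici 0) hlip hs.1 ht.1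
  have hD0 : 0 ≤ D := ENNReal.toReal_nonneg
  have key : ∀ s ∈ Icc 0 D, ∀ t ∈ Icc 0 D, s ≤ t →
      ENNReal.ofReal |s - t| ≤ pathEDist (g s) (g t) := by
    intro s hs t ht hst
    have h1 := (pathEDist_triangle (g 0) (g s) (g D)).trans
      (add_le_add_right (pathEDist_triangle (g s) (g t) (g D)) _)
    have h2 := hle 0 ⟨le_rfl, hD0⟩ s hs
    have h3 := hle t ht D ⟨hD0, le_rfl⟩
    have h4 : pathEDist (g s) (g t) ≠ ⊤ := ne_top_of_le_ne_top ENNReal.ofReal_ne_top (hle s hs t ht)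
    have h5 := h1.trans (add_le_add h2 (add_le_add le_rfl h3))
    have h6 := ENNReal.toReal_mono (by simp [h4]) h5
    rw [hg0, hgD, ← hD, ENNReal.toReal_add ENNReal.ofReal_ne_top (by simp [h4]),
      ENNReal.toReal_add h4 ENNReal.ofReal_ne_top, ENNReal.toReal_ofReal (abs_nonneg _),
      ENNReal.toReal_ofReal (abs_nonneg _), zero_sub, abs_neg, abs_of_nonneg hs.1, abs_sub_comm,
      abs_of_nonneg (sub_nonneg.2 ht.2)] at h6
    rw [abs_sub_comm, abs_of_nonneg (sub_nonneg.2 hst)]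
    exact ENNReal.ofReal_le_of_le_toReal (by linarith)
  refine ⟨g, hg0, hgD, fun s hs t ht => le_antisymm (hle s hs t ht) ?_⟩
  rcases le_total s t with h | h
  · exact key s hs t ht h
  · rw [pathEDist_comm, abs_sub_comm]
    exact key t ht s hs h

end Lipschitz

end Existence

section Uniqueness

open scoped unitInterval

lemma pathEDist_le_edist_of_segment_subset {F : Type*} [NormedAddCommGroup F] [NormedSpace ℝ F]
    {E : Set F} {x y : E} (h : segment ℝ (x : F) y ⊆ E) : pathEDist x y ≤ edist x y := by
  have hm : ∀ τ : I, AffineMap.lineMap (x : F) y (τ : ℝ) ∈ E := fun τ => h <| by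
    rw [segment_eq_image_lineMap]
    exact mem_image_of_mem _ τ.2
  let f : I → E := fun τ => ⟨AffineMap.lineMap (x : F) y (τ : ℝ), hm τ⟩
  have hf : LipschitzWith (nndist x y) f := LipschitzWith.of_dist_le_mul fun τ τ' => by
    rw [Subtype.dist_eq, dist_lineMap_lineMap, mul_comm]
    rfl
  let c : Path x y :=
    ⟨⟨f, hf.continuous⟩, Subtype.ext (by simp [f]), Subtype.ext (by simp [f])⟩
  rw [edist_nndist]
  exact (iInf_le _ c).trans (pathLength_le_of_lipschitzWith c hf)

namespace IsGeodesicSegment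

variable {X : Type*} [MetricSpace X] {γ γ₁ γ₂ : ℝ → X} {D s t : ℝ} {x y : X}

lemma dist_le (h : IsGeodesicSegment γ D x y) (hs : s ∈ Icc 0 D) (ht : t ∈ Icc 0 D) :
    dist (γ s) (γ t) ≤ |s - t| := by
  have := edist_le_pathEDist (γ s) (γ t)
  rwa [h.2.2 s hs t ht, edist_le_ofReal (abs_nonneg _)] at this

lemma eq_of_eq (h₁ : IsGeodesicSegment γ₁ D x y) (h₂ : IsGeodesicSegment γ₂ D x y)
    (hs : s ∈ Icc 0 D) (ht : t ∈ Icc 0 D) (hst : γ₁ s = γ₂ t) : s = t := by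
  have hD : (0 : ℝ) ∈ Icc 0 D := ⟨le_rfl, hs.1.trans hs.2⟩
  have e₁ := h₁.2.2 0 hD s hs
  have e₂ := h₂.2.2 0 hD t ht
  rw [h₁.1, hst] at e₁
  rw [h₂.1, e₁, zero_sub, zero_sub, abs_neg, abs_neg, abs_of_nonneg hs.1, abs_of_nonneg ht.1,
    ENNReal.ofReal_eq_ofReal_iff hs.1 ht.1] at e₂
  exact e₂

lemma dist_eq_of_segment_subset {F : Type*} [NormedAddCommGroup F] [NormedSpace ℝ F]
    {E : Set F} {γ : ℝ → E} {x y : E} (h : IsGeodesicSegment γ D x y) (hs : s ∈ Icc 0 D)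
    (ht : t ∈ Icc 0 D) (hE : segment ℝ (γ s : F) (γ t) ⊆ E) : dist (γ s) (γ t) = |s - t| := by
  refine (h.dist_le hs ht).antisymm ?_
  have := pathEDist_le_edist_of_segment_subset hE
  rwa [h.2.2 s hs t ht, edist_dist, ENNReal.ofReal_le_ofReal_iff dist_nonneg] at this

lemma continuousOn (h : IsGeodesicSegment γ D x y) : ContinuousOn γ (Icc 0 D) :=
  (LipschitzOnWith.of_dist_le_mul (K := 1) fun s hs t ht => by
    simpa [Real.dist_eq] using h.dist_le hs ht).continuousOn

/-- The two geodesics agree at the ends of a maximal interval on which they differ. -/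
lemma exists_Ioo_ne (h₁ : IsGeodesicSegment γ₁ D x y) (h₂ : IsGeodesicSegment γ₂ D x y)
    (ht : t ∈ Icc 0 D) (hne : γ₁ t ≠ γ₂ t) :
    ∃ a b, a < b ∧ Icc a b ⊆ Icc 0 D ∧ γ₁ a = γ₂ a ∧ γ₁ b = γ₂ b ∧
      ∀ s ∈ Ioo a b, γ₁ s ≠ γ₂ s := by
  have hcl : ∀ u v, Icc u v ⊆ Icc 0 D → IsCompact {s ∈ Icc u v | γ₁ s = γ₂ s} := by
    intro u v huv
    refine isCompact_Icc.of_isClosed_subset ?_ (sep_subset _ _)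
    have := ((h₁.continuousOn.mono huv).prodMk (h₂.continuousOn.mono huv)).preimage_isClosed_of_isClosed
      isClosed_Icc (isClosed_diagonal (X := X))
    exact this
  obtain ⟨a, ha, ha'⟩ := (hcl 0 t (Icc_subset_Icc_right ht.2)).exists_isGreatest
    ⟨0, ⟨le_rfl, ht.1⟩, h₁.1.trans h₂.1.symm⟩
  obtain ⟨b, hb, hb'⟩ := (hcl t D (Icc_subset_Icc_left ht.1)).exists_isLeast
    ⟨D, ⟨ht.2, le_rfl⟩, h₁.2.1.trans h₂.2.1.symm⟩
  have hat : a < t := ha.1.2.lt_of_ne fun e => hne (e ▸ ha.2)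
  have htb : t < b := hb.1.1.lt_of_ne fun e => hne (e ▸ hb.2)
  refine ⟨a, b, hat.trans htb, Icc_subset_Icc ha.1.1 hb.1.2, ha.2, hb.2, fun s hs e => ?_⟩
  rcases le_total s t with hst | hst
  · exact absurd (ha' ⟨⟨ha.1.1.trans hs.1.le, hst⟩, e⟩) (not_le.2 hs.1)
  · exact absurd (hb' ⟨⟨hst, hs.2.le.trans hb.1.2⟩, e⟩) (not_le.2 hs.2)

lemma eqOn {F : Type*} [NormedAddCommGroup F] [NormedSpace ℝ F] (φ : F ≃ₗᵢ[ℝ] ℂ) {E : Set F}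
    [SimplyConnectedSpace E] {γ₁ γ₂ : ℝ → E} {x y : E} (h₁ : IsGeodesicSegment γ₁ D x y)
    (h₂ : IsGeodesicSegment γ₂ D x y) : EqOn γ₁ γ₂ (Icc 0 D) := by
  intro t ht
  by_contra hne
  obtain ⟨a, b, hab, hsub, ha, hb, hdiff⟩ := h₁.exists_Ioo_ne h₂ ht hne
  have hD : (0 : ℝ) ≤ D := ht.1.trans ht.2
  let g : (ℝ → E) → ℝ → ℂ := fun γ s => φ (γ (projIcc 0 D hD s))
  have hg : ∀ γ : ℝ → E, ∀ s ∈ Icc a b, g γ s = φ (γ s) := fun γ s hs => by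
    simp only [g, projIcc_of_mem hD (hsub hs)]
  have hcont : ∀ γ, IsGeodesicSegment γ D x y → Continuous (g γ) := fun γ h =>
    φ.continuous.comp (continuous_subtype_val.comp
      (h.continuousOn.domRestrict.comp continuous_projIcc))
  have hinj : ∀ γ, IsGeodesicSegment γ D x y → InjOn (g γ) (Icc a b) := fun γ h s hs t ht e => by
    rw [hg γ s hs, hg γ t ht, φ.injective.eq_iff, Subtype.coe_inj] at e
    exact h.eq_of_eq h (hsub hs) (hsub ht) e
  have hdist : ∀ γ, ∀ s ∈ Icc a b, ∀ t ∈ Icc a b, dist (g γ s) (g γ t) = dist (γ s) (γ t) :=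
    fun γ s hs t ht => by rw [hg γ s hs, hg γ t ht, φ.dist_map, Subtype.dist_eq]
  have hgeo : ∀ γ, IsGeodesicSegment γ D x y → ∀ s ∈ Icc a b, ∀ t ∈ Icc a b,
      segment ℝ (g γ s) (g γ t) ⊆ φ '' E → dist (g γ s) (g γ t) = |s - t| := by
    intro γ h s hs t ht hseg
    rw [hdist γ s hs t ht]
    refine h.dist_eq_of_segment_subset (hsub hs) (hsub ht) fun z hz => ?_
    have : φ z ∈ segment ℝ (g γ s) (g γ t) := by
      rw [hg γ s hs, hg γ t ht]
      exact (image_segment ℝ φ.toLinearEquiv.toLinearMap.toAffineMap _ _).subset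
        (mem_image_of_mem _ hz)
    obtain ⟨z', hz', e⟩ := hseg this
    exact φ.injective e ▸ hz'
  have hal : a ∈ Icc a b := left_mem_Icc.2 hab.le
  have hbr : b ∈ Icc a b := right_mem_Icc.2 hab.le
  have hm : ∀ τ : I, a + τ * (b - a) ∈ Icc a b := fun τ =>
    ⟨by nlinarith [τ.2.1], by nlinarith [τ.2.2]⟩
  have hpath : ∀ γ, IsGeodesicSegment γ D x y → γ a = γ₁ a → γ b = γ₁ b →
      ∃ c : Path (γ₁ a) (γ₁ b), ∀ τ : I, c τ = γ (a + τ * (b - a)) := by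
    intro γ h e e'
    refine ⟨⟨⟨fun τ => γ (a + τ * (b - a)), ?_⟩, by simp [e], by simp [e']⟩, fun τ => rfl⟩
    exact h.continuousOn.comp_continuous (by fun_prop) fun τ => hsub (hm τ)
  let ψ : C(E, ℂ) := ⟨fun e => φ e, φ.continuous.comp continuous_subtype_val⟩
  refine not_isBigon (S := φ '' E) (g₁ := g γ₁) (g₂ := g γ₂) (a := a) (b := b)
    { lt := hab
      cont₁ := hcont _ h₁
      cont₂ := hcont _ h₂
      left := by rw [hg _ a hal, hg _ a hal, ha]
      right := by rw [hg _ b hbr, hg _ b hbr, hb]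
      inj₁ := hinj _ h₁
      inj₂ := hinj _ h₂
      disj := ?_
      mem₁ := fun s _ => mem_image_of_mem _ (Subtype.coe_prop _)
      mem₂ := fun s _ => mem_image_of_mem _ (Subtype.coe_prop _)
      lip₁ := fun s hs t ht => (hdist _ s hs t ht).trans_le (h₁.dist_le (hsub hs) (hsub ht))
      lip₂ := fun s hs t ht => (hdist _ s hs t ht).trans_le (h₂.dist_le (hsub hs) (hsub ht))
      geo₁ := hgeo _ h₁
      geo₂ := hgeo _ h₂
      triv := ?_ }
  · intro s hs t ht e
    rw [hg _ s hs, hg _ t ht, φ.injective.eq_iff, Subtype.coe_inj] at e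
    obtain rfl := h₁.eq_of_eq h₂ (hsub hs) (hsub ht) e
    by_contra! hs'
    exact hdiff s ⟨hs.1.lt_of_ne hs'.1.symm, hs.2.lt_of_ne hs'.2⟩ e
  · intro p hp w₁ w₂ hw₁ hw₂
    obtain ⟨c₁, hc₁⟩ := hpath γ₁ h₁ rfl rfl
    obtain ⟨c₂, hc₂⟩ := hpath γ₂ h₂ ha.symm hb.symm
    refine IsLogIncrement.eq_of_paths hab ψ (fun e he => hp ⟨e, e.2, he⟩) c₁ c₂ (fun τ => ?_)
      (fun τ => ?_) hw₁ hw₂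
    · rw [hc₁, hg _ _ (hm τ)]; rfl
    · rw [hc₂, hg _ _ (hm τ)]; rfl

end IsGeodesicSegment

end Uniqueness

/-- A closed, simply connected subspace of the Euclidean plane in which
every two points are joined by a rectifiable path is uniquely geodesic in the induced
path metric. -/
theorem planar_uniquely_geodesic (E : Set (EuclideanSpace ℝ (Fin 2)))
    (hclosed : IsClosed E) (hsc : SimplyConnectedSpace E)
    (hrect : ∀ x y : E, pathEDist x y ≠ ⊤) (x y : E) :
    (∃ γ : ℝ → E, IsGeodesicSegment γ ((pathEDist x y).toReal) x y) ∧
      ∀ γ₁ γ₂ : ℝ → E, IsGeodesicSegment γ₁ ((pathEDist x y).toReal) x y →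
        IsGeodesicSegment γ₂ ((pathEDist x y).toReal) x y →
          Set.EqOn γ₁ γ₂ (Set.Icc 0 ((pathEDist x y).toReal)) := by
  have : ProperSpace E := ProperSpace.of_isClosed hclosed
  exact ⟨exists_isGeodesicSegment (hrect x y), fun γ₁ γ₂ h₁ h₂ =>
    h₁.eqOn Complex.orthonormalBasisOneI.repr.symm h₂⟩
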